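/- arXiv:2203.07263 — 5 statements merged into one kernel-verified Lean document; each statement's English description precedes it below -/
import Mathlib

section
/- For binary vectors x, z, x', z' ∈ {0,1}^N, the phased Pauli strings multiply as τ_{(x,z)} τ_{(x',z')} = i^{p} τ_{((x+x') mod 2, (z+z') mod 2)}, where p = Σ_{i=1}^N ( z_i x'_i − x_i z'_i + 2(z_i + z'_i)⌊(x_i + x'_i)/2⌋ + 2(x_i + x'_i)⌊(z_i + z'_i)/2⌋ ) mod 4, with x_i, z_i regarded as integers in {0,1}. -/
open Matrix BigOperators

/-- The single-qubit Pauli `X` matrix. -/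
noncomputable def pX : Matrix (Fin 2) (Fin 2) ℂ := !![0, 1; 1, 0]

/-- The single-qubit Pauli `Z` matrix. -/
noncomputable def pZ : Matrix (Fin 2) (Fin 2) ℂ := !![1, 0; 0, -1]

/-- The Pauli string `σ_{(x,z)} = ⊗ᵢ X^{xᵢ} Z^{zᵢ}` as a `2^N × 2^N` matrix, realized on
the `N`-fold tensor product space indexed by `Fin N → Fin 2`. -/
noncomputable def pauliString {N : ℕ} (x z : Fin N → Bool) :
    Matrix (Fin N → Fin 2) (Fin N → Fin 2) ℂ :=
  Matrix.of fun a b => ∏ i, (pX ^ (x i).toNat * pZ ^ (z i).toNat) (a i) (b i)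

/-- The phased Pauli string `τ_{(x,z)} = i^{x·z} σ_{(x,z)}`. -/
noncomputable def phasedPauliString {N : ℕ} (x z : Fin N → Bool) :
    Matrix (Fin N → Fin 2) (Fin N → Fin 2) ℂ :=
  (Complex.I ^ (∑ i, (x i).toNat * (z i).toNat)) • pauliString x z

/-- The summand of the phase exponent, with `xᵢ, zᵢ` regarded as integers in `{0,1}`:
`zᵢx'ᵢ − xᵢz'ᵢ + 2(zᵢ+z'ᵢ)⌊(xᵢ+x'ᵢ)/2⌋ + 2(xᵢ+x'ᵢ)⌊(zᵢ+z'ᵢ)/2⌋`. -/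
def pauliPhaseTerm (xi zi xi' zi' : Bool) : ℤ :=
  (zi.toNat : ℤ) * (xi'.toNat : ℤ) - (xi.toNat : ℤ) * (zi'.toNat : ℤ) +
    2 * ((zi.toNat : ℤ) + (zi'.toNat : ℤ)) * (((xi.toNat : ℤ) + (xi'.toNat : ℤ)) / 2) +
    2 * ((xi.toNat : ℤ) + (xi'.toNat : ℤ)) * (((zi.toNat : ℤ) + (zi'.toNat : ℤ)) / 2)

/-- The one-site factor `i^{xz} X^x Z^z` of a phased Pauli string. -/
noncomputable def phasedPauli (x z : Bool) : Matrix (Fin 2) (Fin 2) ℂ :=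
  Complex.I ^ (x.toNat * z.toNat) • (pX ^ x.toNat * pZ ^ z.toNat)

theorem phasedPauli_mul (x z x' z' : Bool) :
    phasedPauli x z * phasedPauli x' z' =
      Complex.I ^ pauliPhaseTerm x z x' z' • phasedPauli (xor x x') (xor z z') := by
  have h2 : Complex.I ^ (2 : ℤ) = -1 := by simp [zpow_ofNat]
  have h3 : Complex.I ^ (3 : ℤ) = -Complex.I := by simp [zpow_ofNat]
  have h8 : Complex.I ^ (8 : ℤ) = 1 := by
    rw [show (8 : ℤ) = 2 * 4 by norm_num, _root_.zpow_mul, h2]; norm_num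
  cases x <;> cases z <;> cases x' <;> cases z' <;> ext i j <;> fin_cases i <;> fin_cases j <;>
    simp [phasedPauli, pauliPhaseTerm, pX, pZ, Matrix.mul_apply, Fin.sum_univ_two, h3, h8]

theorem phasedPauliString_apply {N : ℕ} (x z : Fin N → Bool) (a b : Fin N → Fin 2) :
    phasedPauliString x z a b = ∏ i, phasedPauli (x i) (z i) (a i) (b i) := by
  simp [phasedPauliString, pauliString, phasedPauli, Finset.prod_mul_distrib,
    Finset.prod_pow_eq_pow_sum]

theorem Complex.I_zpow_emod_four (n : ℤ) : Complex.I ^ (n % 4) = Complex.I ^ n := by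
  have h : Complex.I ^ (4 : ℤ) = 1 := by simp [zpow_ofNat]
  conv_rhs => rw [← Int.emod_add_mul_ediv n 4, zpow_add₀ Complex.I_ne_zero, _root_.zpow_mul, h]
  simp

theorem Complex.I_zpow_sum {ι : Type*} (s : Finset ι) (f : ι → ℤ) :
    Complex.I ^ (∑ i ∈ s, f i) = ∏ i ∈ s, Complex.I ^ f i := by
  classical
  induction s using Finset.induction_on with
  | empty => simp
  | insert i s hi ih =>
    rw [Finset.sum_insert hi, Finset.prod_insert hi, zpow_add₀ Complex.I_ne_zero, ih]

/-- multiplication rule of phased Pauli strings,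
`τ_{(x,z)} τ_{(x',z')} = i^p τ_{((x+x') mod 2, (z+z') mod 2)}` with the phase exponent
`p = ∑ᵢ (zᵢx'ᵢ − xᵢz'ᵢ + 2(zᵢ+z'ᵢ)⌊(xᵢ+x'ᵢ)/2⌋ + 2(xᵢ+x'ᵢ)⌊(zᵢ+z'ᵢ)/2⌋) mod 4`. -/
theorem phasedPauliString_mul
    (N : ℕ) (x z x' z' : Fin N → Bool) :
    phasedPauliString x z * phasedPauliString x' z' =
      Complex.I ^ ((∑ i, pauliPhaseTerm (x i) (z i) (x' i) (z' i)) % (4 : ℤ)) •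
        phasedPauliString (fun i => xor (x i) (x' i)) (fun i => xor (z i) (z' i)) := by
  ext a b
  rw [Complex.I_zpow_emod_four, Complex.I_zpow_sum, Matrix.mul_apply, Matrix.smul_apply,
    smul_eq_mul, phasedPauliString_apply, ← Finset.prod_mul_distrib]
  simp_rw [phasedPauliString_apply, ← Finset.prod_mul_distrib]
  rw [← Fintype.piFinset_univ, ← Finset.prod_univ_sum (fun _ => Finset.univ)
    (fun i c => phasedPauli (x i) (z i) (a i) c * phasedPauli (x' i) (z' i) c (b i))]
  refine Finset.prod_congr rfl fun i _ => ?_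
  rw [← Matrix.mul_apply, phasedPauli_mul, Matrix.smul_apply, smul_eq_mul]
end

section
/- Let (x^1,z^1), …, (x^l,z^l) be binary vector pairs in {0,1}^N × {0,1}^N, write M_j = σ_{(x^j,z^j)}, and let a_j, b_j ∈ ℂ for 1 ≤ j ≤ l. Then Tr( ∏_{j=1}^l (a_j·1 + b_j M_j) ) = 2^N Σ_{y ∈ 𝒩} ζ(y) ∏_{j=1}^l a_j^{1−y_j} b_j^{y_j}, where 𝒩 = { y ∈ {0,1}^l : Σ_j y_j x^j ≡ 0 and Σ_j y_j z^j ≡ 0 (mod 2) componentwise } is the binary null space and ζ(y) = 2^{−N} Tr( ∏_{j=1}^l M_j^{y_j} ) (all products taken in increasing order of j). -/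
open Matrix BigOperators

/-- Multiplication of tensor-product matrices is performed sitewise. -/
theorem piKronecker_mul {ι n R : Type*} [Fintype ι] [DecidableEq ι] [Fintype n] [CommSemiring R]
    (A B : ι → Matrix n n R) :
    (Matrix.of fun a b : ι → n => ∏ i, A i (a i) (b i)) *
        (Matrix.of fun a b : ι → n => ∏ i, B i (a i) (b i)) =
      Matrix.of fun a b : ι → n => ∏ i, (A i * B i) (a i) (b i) := by
  ext a b
  simp only [Matrix.mul_apply, Matrix.of_apply, Finset.prod_univ_sum, Fintype.piFinset_univ,
    Finset.prod_mul_distrib]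

/-- Single-qubit Pauli products commute up to the symplectic sign. -/
theorem pX_pow_mul_pZ_pow_comm (x z x' z' : Bool) :
    (pX ^ x.toNat * pZ ^ z.toNat) * (pX ^ x'.toNat * pZ ^ z'.toNat) =
      (-1 : ℂ) ^ (x.toNat * z'.toNat + z.toNat * x'.toNat) •
        ((pX ^ x'.toNat * pZ ^ z'.toNat) * (pX ^ x.toNat * pZ ^ z.toNat)) := by
  cases x <;> cases z <;> cases x' <;> cases z' <;> ext i j <;> fin_cases i <;> fin_cases j <;>
    simp [pX, pZ]

/-- Pauli strings commute up to the sign given by their symplectic product. -/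
theorem pauliString_mul_comm {N : ℕ} (x z x' z' : Fin N → Bool) :
    pauliString x z * pauliString x' z' =
      (-1 : ℂ) ^ (∑ i, ((x i).toNat * (z' i).toNat + (z i).toNat * (x' i).toNat)) •
        (pauliString x' z' * pauliString x z) := by
  simp only [pauliString, piKronecker_mul]
  ext a b
  simp only [Matrix.of_apply, Matrix.smul_apply, smul_eq_mul, ← Finset.prod_pow_eq_pow_sum,
    ← Finset.prod_mul_distrib]
  refine Finset.prod_congr rfl fun i _ => ?_
  rw [pX_pow_mul_pZ_pow_comm, Matrix.smul_apply, smul_eq_mul]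

/-- A Pauli string in which `X` and `Z` never act on the same site is an involution. -/
theorem pauliString_mul_self {N : ℕ} {x z : Fin N → Bool} (h : ∀ i, x i = false ∨ z i = false) :
    pauliString x z * pauliString x z = 1 := by
  have key : ∀ i, (pX ^ (x i).toNat * pZ ^ (z i).toNat) * (pX ^ (x i).toNat * pZ ^ (z i).toNat)
      = 1 := by
    intro i
    have hX : pX * pX = 1 := by
      ext j k; fin_cases j <;> fin_cases k <;> simp [pX]
    have hZ : pZ * pZ = 1 := by
      ext j k; fin_cases j <;> fin_cases k <;> simp [pZ]
    rcases h i with h | h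
    · cases hz : z i <;> simp [h, hZ]
    · cases hx : x i <;> simp [h, hX]
  simp only [pauliString, piKronecker_mul, key]
  ext a b
  simp only [Matrix.of_apply, Matrix.one_apply, Finset.prod_ite_zero, Finset.prod_const_one,
    Finset.mem_univ, true_imp_iff, funext_iff]

/-- Signs picked up by commuting `U` past each factor accumulate over an ordered product. -/
theorem mul_prod_ofFn_pow_of_anticomm {R : Type*} [Ring R] [Algebra ℂ R] {l : ℕ} (U : R)
    (M : Fin l → R) (n e : Fin l → ℕ) (h : ∀ j, U * M j = (-1 : ℂ) ^ n j • (M j * U)) :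
    U * (List.ofFn fun j => M j ^ e j).prod =
      (-1 : ℂ) ^ (∑ j, e j * n j) • ((List.ofFn fun j => M j ^ e j).prod * U) := by
  have hpow : ∀ j k, U * M j ^ k = (-1 : ℂ) ^ (k * n j) • (M j ^ k * U) := by
    intro j k
    induction k with
    | zero => simp
    | succ k ih =>
      rw [pow_succ, ← mul_assoc, ih, smul_mul_assoc, mul_assoc, h, mul_smul_comm, smul_smul,
        ← pow_add, mul_assoc, add_mul, one_mul]
  induction l with
  | zero => simp
  | succ l ih =>
    rw [List.ofFn_succ, List.prod_cons, Fin.sum_univ_succ, ← mul_assoc, hpow, smul_mul_assoc,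
      mul_assoc, ih (fun j => M j.succ) _ _ (fun j => h j.succ) (fun j => hpow j.succ),
      mul_smul_comm, smul_smul, ← pow_add, mul_assoc]

/-- A matrix anticommuting with an involution is traceless. -/
theorem Matrix.trace_eq_zero_of_anticomm {n : Type*} [Fintype n] [DecidableEq n]
    {U P : Matrix n n ℂ} (hU : U * U = 1) (h : U * P = -(P * U)) : P.trace = 0 := by
  have key : P.trace = -P.trace := by
    calc P.trace = (U * P * U).trace := by rw [Matrix.trace_mul_comm, ← mul_assoc, hU, one_mul]
      _ = -P.trace := by rw [h, neg_mul, mul_assoc, hU, mul_one, Matrix.trace_neg]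
  exact self_eq_neg.mp key

/-- An ordered product of Pauli strings anticommuting with a Pauli involution is traceless. -/
theorem trace_prod_pauliString_eq_zero {N l : ℕ} (x z : Fin l → Fin N → Bool) (e : Fin l → ℕ)
    {u v : Fin N → Bool} (huv : ∀ i, u i = false ∨ v i = false)
    (hodd : Odd (∑ j, e j *
      ∑ i, ((u i).toNat * (z j i).toNat + (v i).toNat * (x j i).toNat))) :
    ((List.ofFn fun j => pauliString (x j) (z j) ^ e j).prod).trace = 0 := by
  refine Matrix.trace_eq_zero_of_anticomm (pauliString_mul_self huv) ?_
  rw [mul_prod_ofFn_pow_of_anticomm _ _ _ e fun j => pauliString_mul_comm u v (x j) (z j),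
    hodd.neg_one_pow, neg_one_smul]

/-- Expansion of an ordered product of affine factors over binary exponent vectors. -/
theorem prod_ofFn_smul_one_add_smul {R : Type*} [Ring R] [Algebra ℂ R] {l : ℕ}
    (a b : Fin l → ℂ) (M : Fin l → R) :
    (List.ofFn fun j => (a j • (1 : R) + b j • M j)).prod =
      ∑ y : Fin l → Bool, (∏ j, a j ^ (1 - (y j).toNat) * b j ^ (y j).toNat) •
        (List.ofFn fun j => M j ^ (y j).toNat).prod := by
  induction l with
  | zero => simp
  | succ l ih =>
    rw [List.ofFn_succ, List.prod_cons, ih (fun j => a j.succ) (fun j => b j.succ),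
      ← (Fin.consEquiv fun _ => Bool).sum_comp, Fintype.sum_prod_type, Fintype.sum_bool, add_mul,
      add_comm, Finset.mul_sum, Finset.mul_sum]
    simp [Fin.consEquiv, Fin.prod_univ_succ, List.ofFn_succ, smul_smul, mul_comm]

/-- the trace formula underlying the classical post-processing of logical
shadow tomography.  With `Mⱼ = σ_{(xʲ,zʲ)}`,
`Tr(∏ⱼ (aⱼ·1 + bⱼ Mⱼ)) = 2^N ∑_{y ∈ 𝒩} ζ(y) ∏ⱼ aⱼ^{1−yⱼ} bⱼ^{yⱼ}`, where `𝒩` is the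
binary null space `{y : ∑ⱼ yⱼ xʲ ≡ 0, ∑ⱼ yⱼ zʲ ≡ 0 (mod 2)}` and
`ζ(y) = 2^{−N} Tr(∏ⱼ Mⱼ^{yⱼ})`. -/
theorem pauliString_affine_product_trace
    (N l : ℕ) (x z : Fin l → Fin N → Bool) (a b : Fin l → ℂ) :
    ((List.ofFn fun j : Fin l =>
        (a j • (1 : Matrix (Fin N → Fin 2) (Fin N → Fin 2) ℂ) +
          b j • pauliString (x j) (z j))).prod).trace =
      (2 : ℂ) ^ N *
        ∑ y ∈ Finset.univ.filter
            (fun y : Fin l → Bool =>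
              ∀ i : Fin N,
                (∑ j, (y j).toNat * (x j i).toNat) % 2 = 0 ∧
                (∑ j, (y j).toNat * (z j i).toNat) % 2 = 0),
          (((2 : ℂ) ^ N)⁻¹ *
              ((List.ofFn fun j : Fin l =>
                  pauliString (x j) (z j) ^ (y j).toNat).prod).trace) *
            ∏ j, a j ^ (1 - (y j).toNat) * b j ^ (y j).toNat := by
  rw [prod_ofFn_smul_one_add_smul, Matrix.trace_sum, Finset.mul_sum, Finset.sum_filter]
  refine Finset.sum_congr rfl fun y _ => ?_
  rw [Matrix.trace_smul, smul_eq_mul]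
  split_ifs with hy
  · rw [mul_assoc, mul_inv_cancel_left₀ (pow_ne_zero N two_ne_zero), mul_comm]
  · suffices h : ((List.ofFn fun j => pauliString (x j) (z j) ^ (y j).toNat).prod).trace = 0 by
      rw [h, mul_zero]
    obtain ⟨i, hi⟩ := not_forall.mp hy
    have hdelta : ∀ k, (decide (k = i)).toNat = if k = i then 1 else 0 := fun k => by
      split_ifs with h <;> simp [h]
    rcases not_and_or.mp hi with hx | hz
    · refine trace_prod_pauliString_eq_zero x z _ (u := fun _ => false)
        (v := fun k => decide (k = i)) (fun _ => Or.inl rfl) ?_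
      simpa [hdelta, Nat.odd_iff] using hx
    · refine trace_prod_pauliString_eq_zero x z _ (u := fun k => decide (k = i))
        (v := fun _ => false) (fun _ => Or.inr rfl) ?_
      simpa [hdelta, Nat.odd_iff] using hz
end

section
/- Let S_1, …, S_r be pairwise commuting Hermitian complex 2^N × 2^N matrices with S_j^2 = 1, Π = ∏_{j=1}^r (1 + S_j)/2, and ψ_0 ∈ ℂ^{2^N} with S_j ψ_0 = ψ_0 for all j. Fix d ≥ 1 and assume that for every pair of binary vectors (x,z) ∈ {0,1}^N × {0,1}^N with 1 ≤ w(x,z) < d there exists an index j with S_j σ_{(x,z)} = − σ_{(x,z)} S_j. Then for every l with 1 ≤ l < d, the l-error density matrix ρ_l = Σ_{(x,z) : w(x,z) = l} σ_{(x,z)} ψ_0 ψ_0ᴴ σ_{(x,z)}ᴴ satisfies Π ρ_l Π = 0. -/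
open Matrix BigOperators

/-- The weight `w(x,z)` of a Pauli string: the number of sites with `(xᵢ,zᵢ) ≠ (0,0)`. -/
def pauliStringWeight {N : ℕ} (x z : Fin N → Bool) : ℕ :=
  (Finset.univ.filter fun i => ¬(x i = false ∧ z i = false)).card

/-- A product of ring elements left-annihilates `b` as soon as one factor does and that factor
commutes with all the others. -/
theorem list_prod_mul_eq_zero_of_commute {R : Type*} [Ring R] {a b : R} (hab : a * b = 0) :
    ∀ {L : List R}, a ∈ L → (∀ c ∈ L, Commute a c) → L.prod * b = 0
  | c :: L, ha, hc => by
    rw [List.prod_cons]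
    rcases List.mem_cons.mp ha with rfl | ha
    · have hL : Commute a L.prod :=
        Commute.list_prod_right _ _ fun e he => hc e (List.mem_cons_of_mem _ he)
      rw [hL.eq, mul_assoc, hab, mul_zero]
    · rw [mul_assoc, list_prod_mul_eq_zero_of_commute hab ha
        fun e he => hc e (List.mem_cons_of_mem _ he), mul_zero]

/-- if every Pauli error of weight strictly between `0` and `d`
anticommutes with some stabilizer generator, then the codespace projector annihilates the
`l`-error density matrix `ρ_l = ∑_{w(x,z)=l} σ_{(x,z)} ψ₀ψ₀ᴴ σ_{(x,z)}ᴴ` for every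
`1 ≤ l < d`: `Π ρ_l Π = 0`. -/
theorem projector_annihilates_low_weight_error_density
    (N r : ℕ) (S : Fin r → Matrix (Fin N → Fin 2) (Fin N → Fin 2) ℂ)
    (hherm : ∀ j, (S j)ᴴ = S j)
    (hsq : ∀ j, S j * S j = 1)
    (hcomm : ∀ i j, S i * S j = S j * S i)
    (ψ₀ : (Fin N → Fin 2) → ℂ)
    (hψ₀ : ∀ j, S j *ᵥ ψ₀ = ψ₀)
    (d : ℕ) (hd : 1 ≤ d)
    (hdetect : ∀ x z : Fin N → Bool,
      1 ≤ pauliStringWeight x z → pauliStringWeight x z < d →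
      ∃ j, S j * pauliString x z = -(pauliString x z * S j))
    (l : ℕ) (hl1 : 1 ≤ l) (hld : l < d) :
    (List.ofFn fun j : Fin r => ((1 / 2 : ℂ) • (1 + S j))).prod *
        (∑ xz ∈ Finset.univ.filter
            (fun xz : (Fin N → Bool) × (Fin N → Bool) =>
              pauliStringWeight xz.1 xz.2 = l),
          pauliString xz.1 xz.2 * vecMulVec ψ₀ (star ψ₀) * (pauliString xz.1 xz.2)ᴴ) *
        (List.ofFn fun j : Fin r => ((1 / 2 : ℂ) • (1 + S j))).prod = 0 := by
  rw [Finset.mul_sum, Finset.sum_mul]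
  refine Finset.sum_eq_zero fun xz hxz => ?_
  have hw : pauliStringWeight xz.1 xz.2 = l := (Finset.mem_filter.mp hxz).2
  obtain ⟨j, hj⟩ := hdetect xz.1 xz.2 (hw ▸ hl1) (hw ▸ hld)
  have hann : ((1 / 2 : ℂ) • (1 + S j)) *
      (pauliString xz.1 xz.2 * vecMulVec ψ₀ (star ψ₀)) = 0 := by
    rw [smul_mul_assoc, add_mul, one_mul, ← mul_assoc, hj, neg_mul, mul_assoc _ (S j),
      mul_vecMulVec (S j), hψ₀, add_neg_cancel, smul_zero]
  rw [← mul_assoc, list_prod_mul_eq_zero_of_commute hann (List.mem_ofFn.mpr ⟨j, rfl⟩) ?_,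
    zero_mul, zero_mul]
  intro c hc
  obtain ⟨i, rfl⟩ := List.mem_ofFn.mp hc
  have hji : Commute (S j) (S i) := hcomm j i
  exact (((Commute.one_left _).add_left
    ((Commute.one_right _).add_right hji)).smul_left _).smul_right _
end

section
/- Let S_1, …, S_r be pairwise commuting Hermitian complex 2^N × 2^N matrices with S_j^2 = 1, Π = ∏_{j=1}^r (1 + S_j)/2, and ψ_0 ∈ ℂ^{2^N} with S_j ψ_0 = ψ_0 for all j. Fix d ≥ 1 and assume that for every pair (x,z) with 1 ≤ w(x,z) < d there exists j with S_j σ_{(x,z)} = − σ_{(x,z)} S_j. Then for any Pauli strings P = σ_{(x,z)} and Q = σ_{(x',z')} with w(x,z) ≥ 1, w(x',z') ≥ 1, and w(x,z) + w(x',z') < 2d, one has Π (P ψ_0 ψ_0ᴴ Pᴴ)(Q ψ_0 ψ_0ᴴ Qᴴ) Π = 0; consequently the leading correction to the projected squared density matrix is of order p^{2d}. -/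
open Matrix BigOperators

/-- A product of pairwise commuting elements annihilates from the left whatever one of its
factors annihilates from the left. -/
theorem List.prod_mul_eq_zero_of_mem {R : Type*} [Semiring R] {l : List R} {a m : R}
    (hl : ∀ b ∈ l, ∀ c ∈ l, Commute b c) (ha : a ∈ l) (ham : a * m = 0) : l.prod * m = 0 := by
  induction l with
  | nil => simp at ha
  | cons b l ih =>
    rw [List.prod_cons]
    rcases List.mem_cons.1 ha with rfl | h
    · have hcomm : Commute a l.prod :=
        Commute.list_prod_right l a fun c hc => hl a (by simp) c (by simp [hc])
      rw [hcomm.eq, mul_assoc, ham, mul_zero]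
    · rw [mul_assoc, ih (fun b hb c hc => hl b (by simp [hb]) c (by simp [hc])) h, mul_zero]

/-- A product of pairwise commuting elements annihilates from the right whatever one of its
factors annihilates from the right. -/
theorem List.mul_prod_eq_zero_of_mem {R : Type*} [Semiring R] {l : List R} {a m : R}
    (hl : ∀ b ∈ l, ∀ c ∈ l, Commute b c) (ha : a ∈ l) (hma : m * a = 0) : m * l.prod = 0 := by
  induction l with
  | nil => simp at ha
  | cons b l ih =>
    rw [List.prod_cons]
    rcases List.mem_cons.1 ha with rfl | h
    · rw [← mul_assoc, hma, zero_mul]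
    · have hcomm : Commute b l.prod :=
        Commute.list_prod_right l b fun c hc => hl b (by simp) c (by simp [hc])
      rw [hcomm.eq, ← mul_assoc, ih (fun b hb c hc => hl b (by simp [hb]) c (by simp [hc])) h,
        zero_mul]

/-- An error `P` that anticommutes with a stabilizer `S` of `ψ` moves the state `ψ ψᴴ` into the
`-1` eigenspace of `S`. -/
theorem stabilizer_mul_error_state {n : Type*} [Fintype n] {S P : Matrix n n ℂ} {ψ : n → ℂ}
    (hψ : S *ᵥ ψ = ψ) (hSP : S * P = -(P * S)) :
    S * (P * vecMulVec ψ (star ψ) * Pᴴ) = -(P * vecMulVec ψ (star ψ) * Pᴴ) := by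
  have h : S * vecMulVec ψ (star ψ) = vecMulVec ψ (star ψ) := by rw [mul_vecMulVec, hψ]
  rw [← Matrix.mul_assoc, ← Matrix.mul_assoc, hSP, Matrix.neg_mul, Matrix.mul_assoc P S, h,
    Matrix.neg_mul]

/-- The right-hand counterpart of `stabilizer_mul_error_state` for a Hermitian stabilizer. -/
theorem error_state_mul_stabilizer {n : Type*} [Fintype n] {S P : Matrix n n ℂ} {ψ : n → ℂ}
    (hS : Sᴴ = S) (hψ : S *ᵥ ψ = ψ) (hSP : S * P = -(P * S)) :
    (P * vecMulVec ψ (star ψ) * Pᴴ) * S = -(P * vecMulVec ψ (star ψ) * Pᴴ) := by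
  have h := congrArg conjTranspose (stabilizer_mul_error_state hψ hSP)
  simpa only [conjTranspose_mul, conjTranspose_neg, conjTranspose_conjTranspose,
    conjTranspose_vecMulVec, star_star, hS, Matrix.mul_assoc] using h

/-- with detectable errors of weight `< d`, for Pauli strings
`P = σ_{(x,z)}`, `Q = σ_{(x',z')}` of positive weights summing to less than `2d`,
`Π (P ψ₀ψ₀ᴴ Pᴴ)(Q ψ₀ψ₀ᴴ Qᴴ) Π = 0`; hence the leading correction to the projected
squared density matrix is of order `p^{2d}`. -/
theorem projector_annihilates_low_weight_squared_error
    (N r : ℕ) (S : Fin r → Matrix (Fin N → Fin 2) (Fin N → Fin 2) ℂ)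
    (hherm : ∀ j, (S j)ᴴ = S j)
    (hsq : ∀ j, S j * S j = 1)
    (hcomm : ∀ i j, S i * S j = S j * S i)
    (ψ₀ : (Fin N → Fin 2) → ℂ)
    (hψ₀ : ∀ j, S j *ᵥ ψ₀ = ψ₀)
    (d : ℕ) (hd : 1 ≤ d)
    (hdetect : ∀ x z : Fin N → Bool,
      1 ≤ pauliStringWeight x z → pauliStringWeight x z < d →
      ∃ j, S j * pauliString x z = -(pauliString x z * S j))
    (x z x' z' : Fin N → Bool)
    (hw1 : 1 ≤ pauliStringWeight x z) (hw2 : 1 ≤ pauliStringWeight x' z')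
    (hsum : pauliStringWeight x z + pauliStringWeight x' z' < 2 * d) :
    (List.ofFn fun j : Fin r => ((1 / 2 : ℂ) • (1 + S j))).prod *
        (pauliString x z * vecMulVec ψ₀ (star ψ₀) * (pauliString x z)ᴴ) *
        (pauliString x' z' * vecMulVec ψ₀ (star ψ₀) * (pauliString x' z')ᴴ) *
        (List.ofFn fun j : Fin r => ((1 / 2 : ℂ) • (1 + S j))).prod = 0 := by
  have hfactors : ∀ b ∈ List.ofFn (fun j : Fin r => ((1 / 2 : ℂ) • (1 + S j))),
      ∀ c ∈ List.ofFn (fun j : Fin r => ((1 / 2 : ℂ) • (1 + S j))), Commute b c := by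
    intro b hb c hc
    obtain ⟨i, rfl⟩ := List.mem_ofFn.1 hb
    obtain ⟨j, rfl⟩ := List.mem_ofFn.1 hc
    have hij : Commute (S i) (S j) := hcomm i j
    exact ((((Commute.one_left _).add_left
      ((Commute.one_right _).add_right hij))).smul_left _).smul_right _
  rcases lt_or_ge (pauliStringWeight x z) d with h | h
  · obtain ⟨j, hj⟩ := hdetect x z hw1 h
    rw [List.prod_mul_eq_zero_of_mem hfactors (List.mem_ofFn.2 ⟨j, rfl⟩), Matrix.zero_mul,
      Matrix.zero_mul]
    rw [Matrix.smul_mul, Matrix.add_mul, Matrix.one_mul, stabilizer_mul_error_state (hψ₀ j) hj,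
      add_neg_cancel, smul_zero]
  · obtain ⟨j, hj⟩ := hdetect x' z' hw2 (by omega)
    rw [Matrix.mul_assoc,
      List.mul_prod_eq_zero_of_mem hfactors (List.mem_ofFn.2 ⟨j, rfl⟩), Matrix.mul_zero]
    rw [Matrix.mul_smul, Matrix.mul_add, Matrix.mul_one,
      error_state_mul_stabilizer (hherm j) (hψ₀ j) hj, add_neg_cancel, smul_zero]
end

section
/- Let d ≥ 2 and l ≥ 1, let P_1, …, P_l be d × d rank-2 orthogonal projections (P_i^2 = P_i, P_iᴴ = P_i, Tr P_i = 2), and let σ be a positive semidefinite d^l × d^l complex matrix with Tr σ = 1. Then Tr( σ · ⊗_{i=1}^l ((2d+2)/(d+2)) (P_i + 1) ) ≤ 4^l, where the tensor product is the iterated Kronecker product. Consequently the squared shadow norm of a projected logical Pauli observable, and hence the single-shot variance of its logical shadow tomography estimator, is at most 4^l, independent of the number n = log₂ d of physical qubits per logical qubit. -/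
open Matrix BigOperators
open scoped ComplexOrder

/-- The `l`-fold Kronecker (tensor) product of a family of `d × d` matrices, realized on
the tensor product space indexed by `Fin l → Fin d`. -/
noncomputable def kron {d l : ℕ} (M : Fin l → Matrix (Fin d) (Fin d) ℂ) :
    Matrix (Fin l → Fin d) (Fin l → Fin d) ℂ :=
  Matrix.of fun a b => ∏ i, M i (a i) (b i)

open scoped MatrixOrder Matrix.Norms.L2Operator in
lemma Matrix.PosSemidef.exists_eq_conjTranspose_mul_self {n : Type*} [Fintype n] [DecidableEq n]
    {A : Matrix n n ℂ} (hA : A.PosSemidef) : ∃ B : Matrix n n ℂ, A = Bᴴ * B :=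
  CStarAlgebra.nonneg_iff_eq_star_mul_self.mp hA.nonneg

/-- The Kronecker product of matrices of the form `(B i)ᴴ * B i` has the same form. -/
lemma kron_conjTranspose_mul_self {d l : ℕ} (B : Fin l → Matrix (Fin d) (Fin d) ℂ) :
    kron (fun i => (B i)ᴴ * B i) = (kron B)ᴴ * kron B := by
  ext a b
  simp only [kron, Matrix.of_apply, Matrix.mul_apply, Matrix.conjTranspose_apply, star_prod,
    ← Finset.prod_mul_distrib]
  exact Fintype.prod_sum fun i j => star (B i j (a i)) * B i j (b i)

lemma kron_posSemidef {d l : ℕ} {M : Fin l → Matrix (Fin d) (Fin d) ℂ}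
    (hM : ∀ i, (M i).PosSemidef) : (kron M).PosSemidef := by
  choose B hB using fun i => (hM i).exists_eq_conjTranspose_mul_self
  obtain rfl : M = fun i => (B i)ᴴ * B i := funext hB
  rw [kron_conjTranspose_mul_self]
  exact Matrix.posSemidef_conjTranspose_mul_self _

lemma kron_smul_one {d l : ℕ} (c : ℂ) :
    kron (fun _ : Fin l => c • (1 : Matrix (Fin d) (Fin d) ℂ)) = c ^ l • 1 := by
  ext a b
  simp [kron, Matrix.one_apply, Finset.prod_ite_zero, funext_iff]

lemma kron_add {d l : ℕ} (M N : Fin l → Matrix (Fin d) (Fin d) ℂ) :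
    kron (fun i => M i + N i) = ∑ t : Finset (Fin l), kron (t.piecewise M N) := by
  ext a b
  simp only [kron, Matrix.of_apply, Matrix.add_apply, Matrix.sum_apply, Finset.prod_add,
    Finset.powerset_univ]
  refine Finset.sum_congr rfl fun t _ => ?_
  rw [← Finset.compl_eq_univ_sdiff, ← Finset.prod_mul_prod_compl t]
  congr 1 <;> refine Finset.prod_congr rfl fun i hi => ?_
  · rw [Finset.piecewise_eq_of_mem _ _ _ hi]
  · rw [Finset.piecewise_eq_of_notMem _ _ _ (Finset.mem_compl.mp hi)]

/-- The Kronecker product is monotone for the Loewner order on positive semidefinite matrices. -/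
lemma kron_add_sub_kron_posSemidef {d l : ℕ} {M N : Fin l → Matrix (Fin d) (Fin d) ℂ}
    (hM : ∀ i, (M i).PosSemidef) (hN : ∀ i, (N i).PosSemidef) :
    (kron (fun i => M i + N i) - kron M).PosSemidef := by
  rw [kron_add, ← Finset.sum_erase_add _ _ (Finset.mem_univ (Finset.univ : Finset (Fin l))),
    Finset.piecewise_univ, add_sub_cancel_right]
  refine Matrix.posSemidef_sum _ fun t _ => kron_posSemidef fun i => ?_
  by_cases hi : i ∈ t
  · simpa [hi] using hM i
  · simpa [hi] using hN i

lemma trace_mul_nonneg_of_posSemidef {n : Type*} [Fintype n] {A B : Matrix n n ℂ}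
    (hA : A.PosSemidef) (hB : B.PosSemidef) : 0 ≤ (A * B).trace := by
  classical
  obtain ⟨C, rfl⟩ := hA.exists_eq_conjTranspose_mul_self
  rw [Matrix.mul_assoc, Matrix.trace_mul_comm]
  exact (hB.mul_mul_conjTranspose_same C).trace_nonneg

/-- the squared shadow norm of a projected logical Pauli observable is at
most `4^l`: for rank-2 orthogonal projections `P₁, …, P_l` and any density matrix `σ`,
`Tr(σ ⊗ᵢ ((2d+2)/(d+2))(Pᵢ + 1)) ≤ 4^l`, independent of the number `n = log₂ d` of
physical qubits per logical qubit. -/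
theorem shadow_norm_bound
    (d l : ℕ) (hd : 2 ≤ d) (hl : 1 ≤ l)
    (P : Fin l → Matrix (Fin d) (Fin d) ℂ)
    (hproj : ∀ i, P i * P i = P i) (hherm : ∀ i, (P i)ᴴ = P i)
    (htr : ∀ i, (P i).trace = 2)
    (σ : Matrix (Fin l → Fin d) (Fin l → Fin d) ℂ)
    (hσ : σ.PosSemidef) (htrσ : σ.trace = 1) :
    (σ * kron fun i => ((2 * (d : ℂ) + 2) / ((d : ℂ) + 2)) • (P i + 1)).trace ≤
      (4 : ℂ) ^ l := by
  obtain ⟨c, hc0, hc2, hc⟩ : ∃ c : ℝ, 0 ≤ c ∧ c ≤ 2 ∧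
      (2 * (d : ℂ) + 2) / ((d : ℂ) + 2) = (c : ℂ) := by
    refine ⟨(2 * d + 2) / (d + 2), by positivity, ?_, by push_cast; rfl⟩
    rw [div_le_iff₀ (by positivity)]
    linarith
  rw [hc]
  have hP : ∀ Q : Matrix (Fin d) (Fin d) ℂ, Qᴴ = Q → Q * Q = Q → Q.PosSemidef := by
    intro Q hQ hQQ
    have h := Matrix.posSemidef_conjTranspose_mul_self Q
    rwa [hQ, hQQ] at h
  have hM : ∀ i, ((c : ℂ) • (P i + 1)).PosSemidef := fun i =>
    ((hP _ (hherm i) (hproj i)).add Matrix.PosSemidef.one).smul (by exact_mod_cast hc0)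
  have hN : ∀ i, ((c : ℂ) • (1 - P i) + (4 - 2 * (c : ℂ)) • 1).PosSemidef := fun i => by
    refine ((hP (1 - P i) (by simp [hherm i]) ?_).smul (by exact_mod_cast hc0)).add
      (Matrix.PosSemidef.one.smul ?_)
    · simp [sub_mul, mul_sub, hproj i]
    · have h : (0 : ℝ) ≤ 4 - 2 * c := by linarith
      exact_mod_cast h
  have hsum : (fun i => (c : ℂ) • (P i + 1) + ((c : ℂ) • (1 - P i) + (4 - 2 * (c : ℂ)) • 1)) =
      fun _ => (4 : ℂ) • 1 := by
    funext i
    module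
  have h := trace_mul_nonneg_of_posSemidef hσ (kron_add_sub_kron_posSemidef hM hN)
  rw [hsum, kron_smul_one, mul_sub, Matrix.trace_sub, Matrix.mul_smul, mul_one,
    Matrix.trace_smul, htrσ, smul_eq_mul, mul_one] at h
  exact sub_nonneg.mp h
end
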